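/- arXiv:1902.08388 — 3 statements merged into one kernel-verified Lean document; each statement's English description precedes it below -/
import Mathlib

section
/- Let A be a real symmetric positive definite n×n matrix (n ≥ 1) and X a real symmetric n×n matrix with ‖XA‖_F = √n. Set w = ⟨XA, I⟩ and D = −(1/n)((w/n)·XA − I), and assume D ≠ 0. Then the function φ(t) = F(X + tD) − F(X), where F(Y) = 1 − ⟨YA, I⟩/(√n‖YA‖_F), is differentiable at t = 0 with φ(0) = 0 and φ'(0) < 0; that is, D is a descent direction for F at X. -/
open Matrix Filter

/-- The Frobenius inner product of two real matrices: `⟪A, B⟫ = trace (Aᵀ * B)`. -/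
noncomputable def finner {m n : ℕ} (A B : Matrix (Fin m) (Fin n) ℝ) : ℝ :=
  (Aᵀ * B).trace

/-- The Frobenius norm of a real matrix: `‖A‖_F = ⟪A, A⟫ ^ (1/2)`. -/
noncomputable def fnorm {m n : ℕ} (A : Matrix (Fin m) (Fin n) ℝ) : ℝ :=
  Real.sqrt (finner A A)

/-- The merit function `F(Y) = 1 − ⟪YA, I⟫ / (√n ‖YA‖_F)`, i.e. `1 − cos(YA, I)`. -/
noncomputable def meritF {n : ℕ} (A Y : Matrix (Fin n) (Fin n) ℝ) : ℝ :=
  1 - finner (Y * A) (1 : Matrix (Fin n) (Fin n) ℝ) / (Real.sqrt n * fnorm (Y * A))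

theorem finner_add_left' {n : ℕ} (A B C : Matrix (Fin n) (Fin n) ℝ) :
    finner (A + B) C = finner A C + finner B C := by
  simp [finner, Matrix.add_mul]

theorem finner_smul_left' {n : ℕ} (r : ℝ) (A C : Matrix (Fin n) (Fin n) ℝ) :
    finner (r • A) C = r * finner A C := by
  simp [finner]

theorem finner_comm' {n : ℕ} (A C : Matrix (Fin n) (Fin n) ℝ) :
    finner A C = finner C A := by
  unfold finner
  rw [← Matrix.trace_transpose, Matrix.transpose_mul, Matrix.transpose_transpose]

theorem finner_pos' {n : ℕ} (A D : Matrix (Fin n) (Fin n) ℝ) (hA : A.PosDef) (hD : D ≠ 0) :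
    0 < finner D (D * A) := by
  have h : finner D (D * A) = ∑ i, (D i) ⬝ᵥ (A *ᵥ (D i)) := by
    unfold finner
    rw [← Matrix.mul_assoc, Matrix.trace_mul_comm, ← Matrix.mul_assoc, Matrix.trace_mul_comm]
    simp only [Matrix.trace, Matrix.diag, Matrix.mul_apply, dotProduct, Matrix.mulVec,
      Matrix.transpose_apply]
  have h0 : ∃ i, D i ≠ 0 := by
    by_contra! hc
    exact hD (funext hc)
  obtain ⟨i, hi⟩ := h0
  rw [h]
  refine Finset.sum_pos' (fun j _ => ?_) ⟨i, Finset.mem_univ i, ?_⟩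
  · simpa using hA.posSemidef.dotProduct_mulVec_nonneg (D j)
  · simpa using hA.dotProduct_mulVec_pos hi

/-- Let `A` be real symmetric positive definite (`n ≥ 1`), `X` real symmetric with
`‖XA‖_F = √n`, `w = ⟪XA, I⟫`, `D = −(1/n)((w/n)·XA − I)`, `D ≠ 0`. Then
`φ(t) = F(X + tD) − F(X)` is differentiable at `0` with `φ(0) = 0` and `φ'(0) < 0`:
`D` is a descent direction for `F` at `X`. -/
theorem mincos_descent_direction (n : ℕ) (hn : 1 ≤ n)
    (A X D : Matrix (Fin n) (Fin n) ℝ) (w : ℝ)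
    (hA : A.PosDef) (hX : X.IsSymm)
    (hnorm : fnorm (X * A) = Real.sqrt n)
    (hw : w = finner (X * A) (1 : Matrix (Fin n) (Fin n) ℝ))
    (hD : D = (-(1 / (n : ℝ))) • ((w / (n : ℝ)) • (X * A) - 1))
    (hD0 : D ≠ 0)
    (φ : ℝ → ℝ) (hφ : ∀ t : ℝ, φ t = meritF A (X + t • D) - meritF A X) :
    φ 0 = 0 ∧ ∃ d : ℝ, HasDerivAt φ d 0 ∧ d < 0 := by
  have hn0 : (0:ℝ) < n := by exact_mod_cast hn
  refine ⟨by simp [hφ], -finner D (D * A), ?_, by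
    have := finner_pos' A D hA hD0
    linarith⟩
  have hMM : finner (X * A) (X * A) = n := by
    unfold fnorm at hnorm
    have h1 : 0 < Real.sqrt (finner (X * A) (X * A)) := by
      rw [hnorm]; exact Real.sqrt_pos.2 hn0
    exact (Real.sqrt_inj (Real.sqrt_pos.1 h1).le hn0.le).1 hnorm
  set b := finner (X * A) (D * A) with hb
  set c := finner (D * A) (D * A) with hc
  set e := finner (D * A) (1 : Matrix (Fin n) (Fin n) ℝ) with he
  have hDN : finner D (D * A) = (1 / n) * (e - w / n * b) := by
    have h1 : D = (1 / (n:ℝ)) • ((1 : Matrix (Fin n) (Fin n) ℝ) + (-(w / n)) • (X * A)) := by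
      rw [hD]; module
    have h2 : finner D (D * A) = finner ((1 / (n:ℝ)) •
      ((1 : Matrix (Fin n) (Fin n) ℝ) + (-(w / n)) • (X * A))) (D * A) := by rw [← h1]
    rw [h2, finner_smul_left', finner_add_left', finner_smul_left', finner_comm' 1]
    ring
  have hf : φ = fun t => (1 - (w + t * e) / (Real.sqrt n * Real.sqrt (n + 2 * t * b + t ^ 2 * c)))
      - meritF A X := by
    funext t
    rw [hφ t]
    unfold meritF fnorm
    have h1 : (X + t • D) * A = X * A + t • (D * A) := by
      rw [Matrix.add_mul, Matrix.smul_mul]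
    have h2 : finner (X * A + t • (D * A)) (X * A + t • (D * A))
        = n + 2 * t * b + t ^ 2 * c := by
      rw [finner_add_left', finner_smul_left', finner_comm' (X * A), finner_comm' (D * A),
        finner_add_left', finner_smul_left', finner_add_left', finner_smul_left', hMM,
        finner_comm' (D * A) (X * A)]
      ring
    rw [h1, h2, finner_add_left', finner_smul_left', ← hw]
  have hs : Real.sqrt n * Real.sqrt n = n := Real.mul_self_sqrt hn0.le
  have hsp : 0 < Real.sqrt n := Real.sqrt_pos.2 hn0
  have hq : HasDerivAt (fun t : ℝ => (n:ℝ) + 2 * t * b + t ^ 2 * c) (2 * b) 0 := by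
    have h1 := ((((hasDerivAt_id (0:ℝ)).const_mul 2).mul_const b).const_add (n:ℝ)).add
      (((hasDerivAt_id (0:ℝ)).pow 2).mul_const c)
    exact h1.congr_deriv (by simp)
  have hp : HasDerivAt (fun t : ℝ => w + t * e) e 0 := by
    simpa using ((hasDerivAt_id (0:ℝ)).mul_const e).const_add w
  have hr := (hq.sqrt (by simpa using hn0.ne')).const_mul (Real.sqrt n)
  have hg := ((hp.div hr (by simp; omega)).const_sub 1).sub_const (meritF A X)
  rw [hf]
  refine hg.congr_deriv ?_
  rw [hDN]
  simp only [mul_zero, zero_mul, add_zero, ne_eq, OfNat.ofNat_ne_zero, not_false_eq_true, zero_pow]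
  rw [hs]
  field_simp
end

section
/- Let A be a real symmetric positive definite n×n matrix (n ≥ 1) and X a real symmetric n×n matrix with ‖XA‖_F = √n. Set w = ⟨XA, I⟩ and D = −(1/n)((w/n)·XA − I), and assume D ≠ 0. Suppose α > 0 satisfies F(X + αD) ≤ F(X + tD) for all t > 0, where F(Y) = 1 − ⟨YA, I⟩/(√n‖YA‖_F). Then the function φ(t) = F(X + tD) − F(X) satisfies φ(0) = 0, φ'(0) < 0, and φ(1) < 0, where in φ the steplength is rescaled as φ(t) = F(X + tαD) − F(X). -/
open Matrix Filter

theorem aux_pos {n : ℕ} (A D : Matrix (Fin n) (Fin n) ℝ) (hA : A.PosDef) (hD0 : D ≠ 0) :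
    0 < finner (D * A) D := by
  have hsym : Aᵀ = A := by simpa using hA.isHermitian.eq
  have e : finner (D * A) D = ∑ i, (D i) ⬝ᵥ (A *ᵥ (D i)) := by
    unfold finner
    simp only [Matrix.trace, Matrix.diag, Matrix.mul_apply, dotProduct, mulVec, transpose_apply]
    rw [Finset.sum_comm]
    refine Finset.sum_congr rfl fun i _ => Finset.sum_congr rfl fun j _ => ?_
    rw [mul_comm]
    congr 1
    refine Finset.sum_congr rfl fun k _ => ?_
    have : A k j = A j k := congrFun (congrFun hsym j) k
    rw [this, mul_comm]
  rw [e]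
  have h0 : ∀ v : Fin n → ℝ, 0 ≤ v ⬝ᵥ (A *ᵥ v) := fun v => by
    simpa using hA.posSemidef.dotProduct_mulVec_nonneg v
  obtain ⟨i, hi⟩ : ∃ i, D i ≠ 0 := by
    by_contra! h
    exact hD0 (funext h)
  refine Finset.sum_pos' (fun i _ => h0 _) ⟨i, Finset.mem_univ _, ?_⟩
  simpa using hA.dotProduct_mulVec_pos hi

theorem aux_comm {n : ℕ} (P Q : Matrix (Fin n) (Fin n) ℝ) : finner P Q = finner Q P := by
  unfold finner
  rw [← Matrix.trace_transpose, Matrix.transpose_mul, Matrix.transpose_transpose]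

theorem aux_add {n : ℕ} (P Q R : Matrix (Fin n) (Fin n) ℝ) (s : ℝ) :
    finner (P + s • Q) R = finner P R + s * finner Q R := by
  simp [finner, Matrix.add_mul]

/-- Let `A` be real symmetric positive definite (`n ≥ 1`), `X` real symmetric with
`‖XA‖_F = √n`, `w = ⟪XA, I⟫`, `D = −(1/n)((w/n)·XA − I)`, `D ≠ 0`. If `α > 0`
minimizes `t ↦ F(X + tD)` over `t > 0`, then `φ(t) = F(X + tαD) − F(X)` satisfies
`φ(0) = 0`, `φ'(0) < 0`, and `φ(1) < 0`. -/
theorem mincos_optimal_step (n : ℕ) (hn : 1 ≤ n)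
    (A X D : Matrix (Fin n) (Fin n) ℝ) (w α : ℝ)
    (hA : A.PosDef) (hX : X.IsSymm)
    (hnorm : fnorm (X * A) = Real.sqrt n)
    (hw : w = finner (X * A) (1 : Matrix (Fin n) (Fin n) ℝ))
    (hD : D = (-(1 / (n : ℝ))) • ((w / (n : ℝ)) • (X * A) - 1))
    (hD0 : D ≠ 0) (hα : 0 < α)
    (hmin : ∀ t : ℝ, 0 < t → meritF A (X + α • D) ≤ meritF A (X + t • D))
    (φ : ℝ → ℝ) (hφ : ∀ t : ℝ, φ t = meritF A (X + (t * α) • D) - meritF A X) :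
    φ 0 = 0 ∧ (∃ d : ℝ, HasDerivAt φ d 0 ∧ d < 0) ∧ φ 1 < 0 := by
  have hn0 : (0:ℝ) < n := by exact_mod_cast hn
  have hBB : finner (X * A) (X * A) = n := by
    unfold fnorm at hnorm
    have h0 : 0 < finner (X * A) (X * A) := Real.sqrt_pos.1 (hnorm ▸ Real.sqrt_pos.2 hn0)
    exact (Real.sqrt_inj h0.le hn0.le).1 hnorm
  obtain ⟨a, ha⟩ : ∃ a, a = finner (D * A) (1 : Matrix (Fin n) (Fin n) ℝ) := ⟨_, rfl⟩
  obtain ⟨b, hb⟩ : ∃ b, b = finner (X * A) (D * A) := ⟨_, rfl⟩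
  obtain ⟨c, hc⟩ : ∃ c, c = finner (D * A) (D * A) := ⟨_, rfl⟩
  have key : 0 < a - w / n * b := by
    have h1 := aux_pos A D hA hD0
    have h2 : a - w / n * b = n * finner (D * A) D := by
      have h3 : (n : ℝ) • D = 1 + (-(w / n)) • (X * A) := by
        rw [hD, smul_smul]
        have : (n:ℝ) * -(1 / (n:ℝ)) = -1 := by field_simp
        rw [this]; module
      have h4 : finner (D * A) ((n:ℝ) • D) = n * finner (D * A) D := by simp [finner]
      rw [← h4, h3, aux_comm, aux_add, ha, hb, aux_comm 1]
      ring
    rw [h2]; positivity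
  have hF : ∀ t, meritF A (X + t • D) =
      1 - (w + t * a) / (Real.sqrt n * Real.sqrt (n + 2 * t * b + t ^ 2 * c)) := by
    intro t
    unfold meritF fnorm
    have e : (X + t • D) * A = X * A + t • (D * A) := by rw [Matrix.add_mul, Matrix.smul_mul]
    have e2 : finner (X * A + t • (D * A)) (X * A + t • (D * A)) =
        n + 2 * t * b + t ^ 2 * c := by
      rw [aux_add, aux_comm (X * A), aux_add, aux_comm (D * A) (X * A + _), aux_add, hBB, ← hc,
        aux_comm (D * A) (X * A), ← hb]
      ring
    rw [e, e2, aux_add, ← hw, ← ha]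
  have hφ0 : φ 0 = 0 := by rw [hφ]; simp
  have hder : HasDerivAt φ (-(α / n * (a - w / n * b))) 0 := by
    have hfun : φ = fun t => 1 - (w + (t * α) * a) /
        (Real.sqrt n * Real.sqrt (n + 2 * (t * α) * b + (t * α) ^ 2 * c)) - meritF A X := by
      funext t; rw [hφ, hF]
    rw [hfun]
    have hid : HasDerivAt (fun t : ℝ => t * α) α 0 := by
      simpa using (hasDerivAt_id (0:ℝ)).mul_const α
    have hnum : HasDerivAt (fun t : ℝ => w + (t * α) * a) (α * a) 0 :=
      (hid.mul_const a).const_add w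
    have hq : HasDerivAt (fun t : ℝ => n + 2 * (t * α) * b + (t * α) ^ 2 * c) (2 * α * b) 0 := by
      have := (((hid.const_mul 2).mul_const b).const_add (n:ℝ)).add ((hid.pow 2).mul_const c)
      refine this.congr_deriv ?_
      simp
    have hsq := (hq.sqrt (by simpa using hn0.ne')).const_mul (Real.sqrt n)
    have hs : Real.sqrt n ≠ 0 := (Real.sqrt_pos.2 hn0).ne'
    have := ((hnum.div hsq (by simpa using hs)).const_sub 1).sub_const (meritF A X)
    refine this.congr_deriv ?_
    have hss : Real.sqrt n ^ 2 = n := Real.sq_sqrt hn0.le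
    simp only [zero_mul, mul_zero, add_zero, ne_eq, OfNat.ofNat_ne_zero, not_false_eq_true, zero_pow]
    rw [← sq, hss]
    field_simp
    try ring
  have hneg : -(α / n * (a - w / n * b)) < 0 := by
    have : 0 < α / n * (a - w / n * b) := by positivity
    linarith
  refine ⟨hφ0, ⟨_, hder, hneg⟩, ?_⟩
  obtain ⟨t, ht, htφ⟩ : ∃ t, 0 < t ∧ φ t < 0 := by
    by_contra! h
    have h1 := hder.tendsto_slope_zero_right
    have h2 := ge_of_tendsto (b := (0:ℝ)) h1 (by
      filter_upwards [self_mem_nhdsWithin] with t ht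
      have ht' : (0:ℝ) < t := ht
      have := h t ht'
      simp only [zero_add, hφ0, sub_zero, smul_eq_mul]
      positivity)
    linarith
  have := hmin (t * α) (by positivity)
  rw [hφ] at htφ ⊢
  rw [one_mul]
  linarith
end

section
/- Let A be a real m×n matrix of full column rank n (so that AᵀA is symmetric positive definite). Let X : ℕ → (n×n real matrices) be a sequence such that X(0) is symmetric positive semidefinite, X(0)·(AᵀA) = (AᵀA)·X(0), trace(X(0)·AᵀA) > 0, and for each k ≥ 0 the following recurrence holds: with C_k = A·X(k), w_k = ⟨C_k, A⟩, D_k = −(1/n)((w_k/n)·C_kᵀ·A − I), B_k = A·D_k, μ_k = ⟨B_kᵀ·A, C_kᵀ·A⟩, β_k = ⟨B_k, A⟩, α_k = |(n·β_k − w_k·μ_k)/(β_k·μ_k − w_k·‖B_kᵀ·A‖_F²)|, Z(k+1) = X(k) + α_k·D_k, and X(k+1) = s_k·√n·Z(k+1)/‖(A·Z(k+1))ᵀ·A‖_F, where s_k = 1 if trace((A·Z(k+1))ᵀ·A) > 0 and s_k = −1 otherwise. Assume that for every k the denominator in the definition of α_k is nonzero, (A·Z(k+1))ᵀ·A ≠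 0, and each Z(k+1) and X(k) is symmetric. Then the sequence X(k) converges to (AᵀA)⁻¹. -/
open Matrix Filter

lemma fi_sum {m n : ℕ} (A B : Matrix (Fin m) (Fin n) ℝ) :
    finner A B = ∑ j, ∑ i, A i j * B i j := by
  simp [finner, Matrix.trace, Matrix.mul_apply]

lemma fi_add_left {m n : ℕ} (A B C : Matrix (Fin m) (Fin n) ℝ) :
    finner (A + B) C = finner A C + finner B C := by
  simp [finner, Matrix.add_mul]

lemma fi_add_right {m n : ℕ} (A B C : Matrix (Fin m) (Fin n) ℝ) :
    finner C (A + B) = finner C A + finner C B := by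
  simp [finner, Matrix.mul_add]

lemma fi_sub_left {m n : ℕ} (A B C : Matrix (Fin m) (Fin n) ℝ) :
    finner (A - B) C = finner A C - finner B C := by
  simp [finner, Matrix.sub_mul]

lemma fi_sub_right {m n : ℕ} (A B C : Matrix (Fin m) (Fin n) ℝ) :
    finner C (A - B) = finner C A - finner C B := by
  simp [finner, Matrix.mul_sub]

lemma fi_smul_left {m n : ℕ} (c : ℝ) (A C : Matrix (Fin m) (Fin n) ℝ) :
    finner (c • A) C = c * finner A C := by
  simp [finner]

lemma fi_smul_right {m n : ℕ} (c : ℝ) (A C : Matrix (Fin m) (Fin n) ℝ) :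
    finner C (c • A) = c * finner C A := by
  simp [finner]

lemma fi_comm {m n : ℕ} (A B : Matrix (Fin m) (Fin n) ℝ) : finner A B = finner B A := by
  simp [fi_sum, mul_comm]

lemma fi_entry {m n : ℕ} (A : Matrix (Fin m) (Fin n) ℝ) (i : Fin m) (j : Fin n) :
    A i j ^ 2 ≤ finner A A := by
  rw [fi_sum]
  calc A i j ^ 2 = A i j * A i j := by ring
    _ ≤ ∑ i, A i j * A i j :=
      Finset.single_le_sum (f := fun i => A i j * A i j) (fun i _ => mul_self_nonneg _)
        (Finset.mem_univ i)
    _ ≤ _ := Finset.single_le_sum (f := fun j => ∑ i, A i j * A i j)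
        (fun j _ => Finset.sum_nonneg fun i _ => mul_self_nonneg _) (Finset.mem_univ j)

lemma fi_nonneg {m n : ℕ} (A : Matrix (Fin m) (Fin n) ℝ) : 0 ≤ finner A A := by
  rw [fi_sum]
  exact Finset.sum_nonneg fun i _ => Finset.sum_nonneg fun i _ => mul_self_nonneg _

lemma fi_eq_zero {m n : ℕ} {A : Matrix (Fin m) (Fin n) ℝ} (h : finner A A = 0) : A = 0 := by
  ext i j
  have := fi_entry A i j
  rw [h] at this
  simpa using pow_eq_zero_iff (two_ne_zero) |>.1 (le_antisymm this (sq_nonneg _))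

lemma fi_cont {m n : ℕ} {α : Type*} [TopologicalSpace α] {f g : α → Matrix (Fin m) (Fin n) ℝ}
    (hf : Continuous f) (hg : Continuous g) : Continuous fun x => finner (f x) (g x) := by
  unfold finner
  fun_prop

/-- search direction as a function of `Y = X S` -/
noncomputable def dirD (n : ℕ) (Y : Matrix (Fin n) (Fin n) ℝ) : Matrix (Fin n) (Fin n) ℝ :=
  (-(1 / (n : ℝ))) • ((Y.trace / (n : ℝ)) • Y - 1)

noncomputable def qbeta {n : ℕ} (S Y : Matrix (Fin n) (Fin n) ℝ) : ℝ := (dirD n Y * S).trace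
noncomputable def qmu {n : ℕ} (S Y : Matrix (Fin n) (Fin n) ℝ) : ℝ := finner (dirD n Y * S) Y
noncomputable def qnu {n : ℕ} (S Y : Matrix (Fin n) (Fin n) ℝ) : ℝ :=
  finner (dirD n Y * S) (dirD n Y * S)
noncomputable def qnum {n : ℕ} (S Y : Matrix (Fin n) (Fin n) ℝ) : ℝ :=
  n * qbeta S Y - Y.trace * qmu S Y
noncomputable def qden {n : ℕ} (S Y : Matrix (Fin n) (Fin n) ℝ) : ℝ :=
  qbeta S Y * qmu S Y - Y.trace * qnu S Y
noncomputable def qgain {n : ℕ} (S Y : Matrix (Fin n) (Fin n) ℝ) : ℝ :=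
  qnum S Y ^ 2 * (2 * Y.trace * |qden S Y| + n * qbeta S Y ^ 2 - Y.trace ^ 2 * qnu S Y)
noncomputable def qQ {n : ℕ} (S Y : Matrix (Fin n) (Fin n) ℝ) : ℝ :=
  qden S Y ^ 2 * n + 2 * |qden S Y| * qnum S Y * qmu S Y + qnum S Y ^ 2 * qnu S Y

lemma cont_dirD (n : ℕ) : Continuous (dirD n) := by
  unfold dirD
  fun_prop

lemma cont_beta {n : ℕ} (S : Matrix (Fin n) (Fin n) ℝ) : Continuous (qbeta S) := by
  have := cont_dirD n
  unfold qbeta; fun_prop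
lemma cont_mu {n : ℕ} (S : Matrix (Fin n) (Fin n) ℝ) : Continuous (qmu S) := by
  have := cont_dirD n
  unfold qmu; exact fi_cont (by fun_prop) (by fun_prop)
lemma cont_nu {n : ℕ} (S : Matrix (Fin n) (Fin n) ℝ) : Continuous (qnu S) := by
  have := cont_dirD n
  unfold qnu; exact fi_cont (by fun_prop) (by fun_prop)
lemma cont_num {n : ℕ} (S : Matrix (Fin n) (Fin n) ℝ) : Continuous (qnum S) := by
  have := cont_beta S
  have := cont_mu S
  unfold qnum; fun_prop
lemma cont_den {n : ℕ} (S : Matrix (Fin n) (Fin n) ℝ) : Continuous (qden S) := by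
  have := cont_beta S
  have := cont_mu S
  have := cont_nu S
  unfold qden; fun_prop
lemma cont_gain {n : ℕ} (S : Matrix (Fin n) (Fin n) ℝ) : Continuous (qgain S) := by
  have := cont_beta S
  have := cont_num S
  have := cont_nu S
  have := (cont_den S).abs
  unfold qgain; fun_prop
lemma cont_Q {n : ℕ} (S : Matrix (Fin n) (Fin n) ℝ) : Continuous (qQ S) := by
  have := cont_mu S
  have := cont_num S
  have := cont_nu S
  have := cont_den S
  have := (cont_den S).abs
  unfold qQ; fun_prop

lemma Q_eq {n : ℕ} (S Y : Matrix (Fin n) (Fin n) ℝ) (hY : finner Y Y = n) :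
    qQ S Y = finner (|qden S Y| • Y + qnum S Y • (dirD n Y * S))
      (|qden S Y| • Y + qnum S Y • (dirD n Y * S)) := by
  simp only [fi_add_left, fi_add_right, fi_smul_left, fi_smul_right, hY,
    fi_comm Y (dirD n Y * S)]
  unfold qQ qmu qnu
  rw [← sq_abs (qden S Y)]
  ring

lemma bracket_ge {n : ℕ} (S Y : Matrix (Fin n) (Fin n) ℝ) (hY : finner Y Y = n)
    (hw : 0 ≤ Y.trace) :
    finner (Y.trace • (dirD n Y * S) - qbeta S Y • Y) (Y.trace • (dirD n Y * S) - qbeta S Y • Y)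
      ≤ 2 * Y.trace * |qden S Y| + n * qbeta S Y ^ 2 - Y.trace ^ 2 * qnu S Y := by
  have h := mul_le_mul_of_nonneg_left (neg_le_abs (qden S Y)) hw
  simp only [fi_sub_left, fi_sub_right, fi_smul_left, fi_smul_right, hY,
    fi_comm Y (dirD n Y * S)]
  change _ * (_ * qnu S Y - _ * qmu S Y) - _ * (_ * qmu S Y - _) ≤ _
  have e : qden S Y = qbeta S Y * qmu S Y - Y.trace * qnu S Y := rfl
  have h2 : Y.trace * -qden S Y
    = Y.trace * -(qbeta S Y * qmu S Y - Y.trace * qnu S Y) := by rw [← e]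
  nlinarith

lemma gain_nonneg {n : ℕ} (S Y : Matrix (Fin n) (Fin n) ℝ) (hY : finner Y Y = n)
    (hw : 0 ≤ Y.trace) : 0 ≤ qgain S Y :=
  mul_nonneg (sq_nonneg _) ((fi_nonneg _).trans (bracket_ge S Y hY hw))

lemma num_of_gain {n : ℕ} (S Y : Matrix (Fin n) (Fin n) ℝ) (hY : finner Y Y = n)
    (hw : 0 < Y.trace) (hg : qgain S Y = 0) : qnum S Y = 0 := by
  rcases mul_eq_zero.1 hg with h | h
  · exact pow_eq_zero_iff two_ne_zero |>.1 h
  · have h1 := bracket_ge S Y hY hw.le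
    rw [h] at h1
    have h2 := fi_eq_zero (le_antisymm h1 (fi_nonneg _))
    have h3 : finner (Y.trace • (dirD n Y * S) - qbeta S Y • Y) Y = 0 := by
      rw [h2]; simp [finner]
    rw [fi_sub_left, fi_smul_left, fi_smul_left, hY] at h3
    unfold qnum qmu
    linarith

lemma num_eq {n : ℕ} (hn : 1 ≤ n) (S Y : Matrix (Fin n) (Fin n) ℝ) :
    qnum S Y = (n : ℝ) ^ 2 * finner (dirD n Y * S) (dirD n Y) := by
  have hn' : (n : ℝ) ≠ 0 := by positivity
  have h : ((n : ℝ) ^ 2) • dirD n Y = (n : ℝ) • (1 : Matrix (Fin n) (Fin n) ℝ) - Y.trace • Y := by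
    unfold dirD
    ext i j
    simp only [Matrix.smul_apply, Matrix.sub_apply, smul_eq_mul]
    field_simp
    ring
  rw [← fi_smul_right, h, fi_sub_right, fi_smul_right, fi_smul_right]
  unfold qnum qbeta qmu
  congr 2
  simp [finner]
  exact Matrix.trace_mul_comm _ _

lemma num_D {m n : ℕ} (hn : 1 ≤ n) (A : Matrix (Fin m) (Fin n) ℝ) (hA : IsUnit (Aᵀ * A))
    (Y : Matrix (Fin n) (Fin n) ℝ) (hY : Yᵀ = Y) (h : qnum (Aᵀ * A) Y = 0) :
    dirD n Y = 0 := by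
  have hn' : (n : ℝ) ^ 2 ≠ 0 := by positivity
  have hs : (dirD n Y)ᵀ = dirD n Y := by
    unfold dirD; simp [Matrix.transpose_sub, hY]
  rw [num_eq hn] at h
  have h := (mul_eq_zero.1 h).resolve_left hn'
  have h2 : finner (A * dirD n Y) (A * dirD n Y) = 0 := by
    rw [← h]
    unfold finner
    simp only [Matrix.transpose_mul, hs, Matrix.transpose_transpose]
    rw [Matrix.mul_assoc, Matrix.trace_mul_comm]
    simp only [Matrix.mul_assoc]
  have h3 := fi_eq_zero h2
  have h4 : (Aᵀ * A) * dirD n Y = 0 := by rw [Matrix.mul_assoc, h3, Matrix.mul_zero]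
  exact hA.mul_right_eq_zero.1 h4

lemma trace_of_D {n : ℕ} (hn : 1 ≤ n) (Y : Matrix (Fin n) (Fin n) ℝ) (hw : 0 < Y.trace)
    (h : dirD n Y = 0) : Y.trace = n := by
  have hn' : (0 : ℝ) < n := by positivity
  have h1 : (dirD n Y).trace = 0 := by rw [h]; simp
  unfold dirD at h1
  simp at h1
  rcases h1 with h1 | h1
  · omega
  · field_simp at h1
    nlinarith

/-- Abstract convergence of the traces. -/
lemma trace_tendsto {m n : ℕ} (hn : 1 ≤ n) (A : Matrix (Fin m) (Fin n) ℝ)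
    (hA : IsUnit (Aᵀ * A)) (Y : ℕ → Matrix (Fin n) (Fin n) ℝ)
    (hsym : ∀ k, (Y k)ᵀ = Y k) (hY : ∀ k, finner (Y k) (Y k) = n)
    (hw : ∀ k, 0 < (Y k).trace)
    (hQ : ∀ k, 0 < qQ (Aᵀ * A) (Y k))
    (hstep : ∀ k, (Y (k + 1)).trace ^ 2 * qQ (Aᵀ * A) (Y k) =
      (Y k).trace ^ 2 * qQ (Aᵀ * A) (Y k) + qgain (Aᵀ * A) (Y k)) :
    Tendsto (fun k => (Y k).trace) atTop (nhds (n : ℝ)) := by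
  have hn' : (1 : ℝ) ≤ n := by exact_mod_cast hn
  have hmono : Monotone fun k => (Y k).trace := by
    refine monotone_nat_of_le_succ fun k => ?_
    have h1 := gain_nonneg (Aᵀ * A) (Y k) (hY k) (hw k).le
    have h2 : (Y k).trace ^ 2 ≤ (Y (k + 1)).trace ^ 2 := by
      refine le_of_mul_le_mul_right ?_ (hQ k)
      linarith [hstep k]
    exact (pow_le_pow_iff_left₀ (hw k).le (hw _).le two_ne_zero).1 h2
  have hbdd : ∀ k, (Y k).trace ≤ n := fun k => by
    have h := fi_nonneg (Y k - 1)
    rw [fi_sub_left, fi_sub_right, fi_sub_right, hY, fi_comm 1 (Y k)] at h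
    simp [finner] at h
    linarith
  have hlim := tendsto_atTop_ciSup hmono ⟨n, by rintro _ ⟨k, rfl⟩; exact hbdd k⟩
  set L := ⨆ k, (Y k).trace
  have hK : IsCompact (Set.pi Set.univ fun _ : Fin n => Set.pi Set.univ fun _ : Fin n =>
      Set.Icc (-(n : ℝ)) n) :=
    isCompact_univ_pi fun _ => isCompact_univ_pi fun _ => isCompact_Icc
  have hmem : ∀ k, Y k ∈ (Set.pi Set.univ fun _ : Fin n => Set.pi Set.univ fun _ : Fin n =>
      Set.Icc (-(n : ℝ)) n) := by
    intro k i _ j _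
    have h := fi_entry (Y k) i j
    rw [hY] at h
    exact abs_le.1 (abs_le_of_sq_le_sq (by nlinarith) (by positivity))
  obtain ⟨Yb, -, φ, hφ, hφY⟩ := hK.tendsto_subseq hmem
  change Tendsto (Y ∘ φ) atTop (nhds (Yb : Matrix (Fin n) (Fin n) ℝ)) at hφY
  have hc : ∀ {f : Matrix (Fin n) (Fin n) ℝ → ℝ}, Continuous f →
      Tendsto (fun k => f (Y (φ k))) atTop (nhds (f Yb)) := fun hf =>
    (hf.tendsto Yb).comp hφY
  have htr : Continuous (Matrix.trace : Matrix (Fin n) (Fin n) ℝ → ℝ) := by fun_prop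
  have hL : Matrix.trace (R := ℝ) Yb = L :=
    tendsto_nhds_unique (hc htr) (hlim.comp hφ.tendsto_atTop)
  have hL' : Tendsto (fun k => (Y (φ k + 1)).trace) atTop (nhds L) :=
    hlim.comp ((tendsto_add_atTop_nat 1).comp hφ.tendsto_atTop)
  have hpos : 0 < L := (hw 0).trans_le (hmono.ge_of_tendsto hlim 0)
  have hYb : finner Yb Yb = n := by
    refine tendsto_nhds_unique (hc (f := fun M => finner M M) (fi_cont continuous_id continuous_id)) ?_
    simp only [hY]
    exact tendsto_const_nhds
  have hYs : Matrix.transpose Yb = Yb := by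
    have h1 : Tendsto (fun k => (Y (φ k))ᵀ) atTop (nhds (Matrix.transpose Yb)) :=
      ((continuous_id.matrix_transpose).tendsto Yb).comp hφY
    simp only [hsym] at h1
    exact tendsto_nhds_unique h1 hφY
  have hg : qgain (Aᵀ * A) Yb = 0 := by
    have h1 := (hL'.pow 2).mul (hc (cont_Q (Aᵀ * A)))
    have h2 := (((hc htr).pow 2).mul (hc (cont_Q (Aᵀ * A)))).add (hc (cont_gain (Aᵀ * A)))
    have h3 := tendsto_nhds_unique (h1.congr fun k => hstep (φ k)) h2
    rw [hL] at h3
    linarith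
  rw [← hL] at hpos
  have := trace_of_D hn Yb hpos
    (num_D hn A hA Yb hYs (num_of_gain _ _ hYb hpos hg))
  rw [← this, hL]
  exact hlim

lemma isUnit_gram {m n : ℕ} (A : Matrix (Fin m) (Fin n) ℝ) (hrank : A.rank = n) :
    IsUnit (Aᵀ * A) := by
  have h : (Aᵀ * A).rank = n := by rw [Matrix.rank_transpose_mul_self, hrank]
  rw [← Matrix.mulVec_surjective_iff_isUnit]
  have h2 : LinearMap.range (Aᵀ * A).mulVecLin = ⊤ := by
    apply Submodule.eq_top_of_finrank_eq
    rw [Module.finrank_fin_fun]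
    exact h
  exact LinearMap.range_eq_top.1 h2

/-- Convergence of the MinCos iteration adapted to least-squares problems: for a real
`m×n` matrix `A` of full column rank `n` (so that `AᵀA` is symmetric positive
definite) and the sequence `X(k)` generated by Algorithm 2 from an initial symmetric
positive semidefinite `X(0)` commuting with `AᵀA` and with `trace (X(0)·AᵀA) > 0`,
the sequence `X(k)` converges to `(AᵀA)⁻¹`. -/
theorem mincos_ls_converges (m n : ℕ) (hn : 1 ≤ n)
    (A : Matrix (Fin m) (Fin n) ℝ) (hrank : A.rank = n)
    (X Z D : ℕ → Matrix (Fin n) (Fin n) ℝ)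
    (C B : ℕ → Matrix (Fin m) (Fin n) ℝ)
    (w μ β αs s : ℕ → ℝ)
    (hX0 : (X 0).PosSemidef)
    (hcomm : X 0 * (Aᵀ * A) = (Aᵀ * A) * X 0)
    (htr0 : 0 < (X 0 * (Aᵀ * A)).trace)
    (hC : ∀ k, C k = A * X k)
    (hw : ∀ k, w k = finner (C k) A)
    (hD : ∀ k, D k = (-(1 / (n : ℝ))) • ((w k / (n : ℝ)) • ((C k)ᵀ * A) - 1))
    (hB : ∀ k, B k = A * D k)
    (hμ : ∀ k, μ k = finner ((B k)ᵀ * A) ((C k)ᵀ * A))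
    (hβ : ∀ k, β k = finner (B k) A)
    (hden : ∀ k, β k * μ k - w k * fnorm ((B k)ᵀ * A) ^ 2 ≠ 0)
    (hαs : ∀ k, αs k = |((n : ℝ) * β k - w k * μ k) /
        (β k * μ k - w k * fnorm ((B k)ᵀ * A) ^ 2)|)
    (hZ : ∀ k, Z (k + 1) = X k + αs k • D k)
    (hZA : ∀ k, (A * Z (k + 1))ᵀ * A ≠ 0)
    (hZsym : ∀ k, (Z (k + 1)).IsSymm)
    (hXsym : ∀ k, (X k).IsSymm)
    (hs : ∀ k, s k = if 0 < ((A * Z (k + 1))ᵀ * A).trace then (1 : ℝ) else -1)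
    (hXnext : ∀ k, X (k + 1) =
      (s k * Real.sqrt n / fnorm ((A * Z (k + 1))ᵀ * A)) • Z (k + 1)) :
    Filter.Tendsto X Filter.atTop (nhds (Aᵀ * A)⁻¹) := by
  have hn0 : (0 : ℝ) < n := by exact_mod_cast hn
  have hA : IsUnit (Aᵀ * A) := isUnit_gram A hrank
  obtain ⟨S, hS⟩ : ∃ S, S = Aᵀ * A := ⟨_, rfl⟩
  have hSs : Sᵀ = S := by rw [hS]; simp [Matrix.transpose_mul]
  have eC : ∀ k, (C k)ᵀ * A = X k * S := fun k => by
    rw [hC, Matrix.transpose_mul, (hXsym k).eq, Matrix.mul_assoc, hS]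
  have ew : ∀ k, w k = (X k * S).trace := fun k => by
    rw [hw, finner, eC]
  have eD : ∀ k, D k = dirD n (X k * S) := fun k => by
    rw [hD, eC, ew]; rfl
  have hcm : ∀ k, X k * S = S * X k := by
    intro k
    induction k with
    | zero => rw [hS]; exact hcomm
    | succ k ih =>
      have h1 : Commute (X k) S := ih
      have h2 : Commute (D k) S := by
        rw [eD]; unfold dirD
        exact Commute.smul_left (Commute.sub_left (Commute.smul_left
          (h1.mul_left (Commute.refl S)) _) (Commute.one_left S)) _
      rw [hXnext, hZ]
      exact Commute.smul_left (h1.add_left (h2.smul_left _)) _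
  have hYs : ∀ k, (X k * S)ᵀ = X k * S := fun k => by
    rw [Matrix.transpose_mul, hSs, (hXsym k).eq, hcm]
  have hDs : ∀ k, (D k)ᵀ = D k := fun k => by
    rw [eD]; unfold dirD
    simp only [Matrix.transpose_smul, Matrix.transpose_sub, hYs, Matrix.transpose_one]
  have eB : ∀ k, (B k)ᵀ * A = dirD n (X k * S) * S := fun k => by
    rw [hB, Matrix.transpose_mul, hDs, Matrix.mul_assoc, ← hS, eD]
  have eβ : ∀ k, β k = qbeta S (X k * S) := fun k => by
    rw [hβ, finner, eB]; rfl
  have eμ : ∀ k, μ k = qmu S (X k * S) := fun k => by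
    rw [hμ, eB, eC]; rfl
  have eν : ∀ k, fnorm ((B k)ᵀ * A) ^ 2 = qnu S (X k * S) := fun k => by
    rw [fnorm, Real.sq_sqrt (fi_nonneg _), eB]; rfl
  have hden' : ∀ k, qden S (X k * S) ≠ 0 := fun k => by
    have := hden k
    rw [eβ, eμ, eν, ew] at this
    exact this
  have eα : ∀ k, αs k = |qnum S (X k * S) / qden S (X k * S)| := fun k => by
    rw [hαs, eβ, eμ, eν, ew]; rfl
  have eZ : ∀ k, (A * Z (k + 1))ᵀ * A = X k * S + αs k • (dirD n (X k * S) * S) := fun k => by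
    rw [Matrix.transpose_mul, (hZsym k).eq, Matrix.mul_assoc, ← hS, hZ, Matrix.add_mul,
      Matrix.smul_mul, eD]
  have eY : ∀ k, X (k + 1) * S = (s k * Real.sqrt n / fnorm ((A * Z (k + 1))ᵀ * A)) •
      ((A * Z (k + 1))ᵀ * A) := fun k => by
    rw [hXnext, Matrix.smul_mul]
    congr 1
    rw [Matrix.transpose_mul, (hZsym k).eq, Matrix.mul_assoc, ← hS]
  have hfpos : ∀ k, 0 < finner ((A * Z (k + 1))ᵀ * A) ((A * Z (k + 1))ᵀ * A) := fun k =>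
    lt_of_le_of_ne (fi_nonneg _) fun h => hZA k (fi_eq_zero h.symm)
  have hs2 : ∀ k, s k ^ 2 = 1 := fun k => by
    rw [hs]; split_ifs <;> norm_num
  have hc2 : ∀ k, (s k * Real.sqrt n / fnorm ((A * Z (k + 1))ᵀ * A)) ^ 2 *
      finner ((A * Z (k + 1))ᵀ * A) ((A * Z (k + 1))ᵀ * A) = n := fun k => by
    rw [div_pow, mul_pow, hs2, Real.sq_sqrt hn0.le, fnorm, Real.sq_sqrt (fi_nonneg _), one_mul,
      div_mul_cancel₀ _ (hfpos k).ne']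
  have hYn : ∀ k, finner (X (k + 1) * S) (X (k + 1) * S) = n := fun k => by
    rw [eY, fi_smul_left, fi_smul_right, ← mul_assoc, ← sq, hc2]
  have hwn : ∀ k, 0 ≤ (X (k + 1) * S).trace := fun k => by
    rw [eY, Matrix.trace_smul, smul_eq_mul]
    have h1 : 0 ≤ Real.sqrt n / fnorm ((A * Z (k + 1))ᵀ * A) :=
      div_nonneg (Real.sqrt_nonneg _) (Real.sqrt_nonneg _)
    have h2 : 0 ≤ s k * ((A * Z (k + 1))ᵀ * A).trace := by
      rw [hs]
      split_ifs with h
      · linarith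
      · linarith
    calc 0 ≤ Real.sqrt n / fnorm ((A * Z (k + 1))ᵀ * A) * (s k * ((A * Z (k + 1))ᵀ * A).trace) :=
          mul_nonneg h1 h2
      _ = _ := by ring
  have hnum : ∀ k, 0 ≤ qnum S (X k * S) := fun k => by
    rw [num_eq hn]
    refine mul_nonneg (by positivity) ?_
    have : finner (dirD n (X k * S) * S) (dirD n (X k * S)) =
        finner (A * dirD n (X k * S)) (A * dirD n (X k * S)) := by
      have h := hDs k
      rw [eD] at h
      unfold finner
      simp only [Matrix.transpose_mul, h, hSs]
      rw [Matrix.trace_mul_comm]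
      simp only [Matrix.mul_assoc]
      congr 2
      rw [← Matrix.mul_assoc, hS]
    rw [this]
    exact fi_nonneg _
  have eP : ∀ k, |qden S (X k * S)| • ((A * Z (k + 1))ᵀ * A) =
      |qden S (X k * S)| • (X k * S) + qnum S (X k * S) • (dirD n (X k * S) * S) := fun k => by
    rw [eZ, smul_add, smul_smul, eα, abs_div, abs_of_nonneg (hnum k),
      mul_div_cancel₀ _ (abs_ne_zero.2 (hden' k))]
  have eQ : ∀ k, qQ S (X (k + 1) * S) = qden S (X (k + 1) * S) ^ 2 *
      finner ((A * Z (k + 1 + 1))ᵀ * A) ((A * Z (k + 1 + 1))ᵀ * A) := fun k => by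
    rw [Q_eq S _ (hYn k), ← eP, fi_smul_left, fi_smul_right, ← mul_assoc, ← sq, sq_abs]
  have hQ : ∀ k, 0 < qQ S (X (k + 1) * S) := fun k => by
    rw [eQ]
    exact mul_pos (sq_pos_iff.2 (hden' _)) (hfpos _)
  have eT : ∀ k, (X (k + 1 + 1) * S).trace ^ 2 * qQ S (X (k + 1) * S) =
      n * (|qden S (X (k + 1) * S)| * (X (k + 1) * S).trace +
        qnum S (X (k + 1) * S) * qbeta S (X (k + 1) * S)) ^ 2 := fun k => by
    have h1 := congrArg Matrix.trace (eP (k + 1))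
    simp only [Matrix.trace_smul, Matrix.trace_add, smul_eq_mul] at h1
    change _ = _ + _ * qbeta S (X (k + 1) * S) at h1
    rw [← h1, eQ, eY (k + 1), Matrix.trace_smul, smul_eq_mul]
    have h2 := hc2 (k + 1)
    rw [mul_pow, mul_pow, sq_abs]
    linear_combination (qden S (X (k + 1) * S) ^ 2 * ((A * Z (k + 1 + 1))ᵀ * A).trace ^ 2) * h2
  have hstep : ∀ k, (X (k + 1 + 1) * S).trace ^ 2 * qQ S (X (k + 1) * S) =
      (X (k + 1) * S).trace ^ 2 * qQ S (X (k + 1) * S) + qgain S (X (k + 1) * S) := fun k => by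
    rw [eT]
    have e1 : qnum S (X (k + 1) * S) =
      n * qbeta S (X (k + 1) * S) - (X (k + 1) * S).trace * qmu S (X (k + 1) * S) := rfl
    unfold qQ qgain
    generalize qnum S (X (k + 1) * S) = N at *
    generalize qbeta S (X (k + 1) * S) = b at *
    generalize qmu S (X (k + 1) * S) = u at *
    generalize qnu S (X (k + 1) * S) = v at *
    rw [← sq_abs (qden S (X (k + 1) * S))]
    generalize |qden S (X (k + 1) * S)| = d at *
    generalize (X (k + 1) * S).trace = t at *
    linear_combination (-2 * t * d * N) * e1
  have hpos : ∀ k, 0 < (X (k + 1 + 1) * S).trace := fun k => by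
    refine lt_of_le_of_ne (hwn _) fun h => ?_
    have h0 := hstep k
    have hT := eT k
    have hg := gain_nonneg S _ (hYn k) (hwn k)
    rw [← h] at h0 hT
    have h3 : (X (k + 1) * S).trace = 0 := by
      by_contra hne
      have := mul_pos (sq_pos_iff.2 hne) (hQ k)
      linarith
    have hd := hden' (k + 1)
    unfold qden at hd
    rw [h3] at hd hT
    have hb : qbeta S (X (k + 1) * S) ≠ 0 := by
      intro hb; rw [hb] at hd; simp at hd
    unfold qnum at hT
    rw [h3] at hT
    have : (n : ℝ) * (n * qbeta S (X (k + 1) * S) * qbeta S (X (k + 1) * S)) ^ 2 ≠ 0 := by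
      positivity
    apply this
    linarith
  have key : Tendsto (fun k => (X (k + 1 + 1) * S).trace) atTop (nhds (n : ℝ)) := by
    have hsteps := hstep
    subst hS
    exact trace_tendsto hn A hA (fun k => X (k + 1 + 1) * (Aᵀ * A)) (fun k => hYs _)
      (fun k => hYn _) hpos (fun k => hQ _) (fun k => hsteps _)
  have hY1 : Tendsto (fun k => X (k + 1 + 1) * S) atTop (nhds 1) := by
    have hz : Tendsto (fun k => Real.sqrt (2 * (n - (X (k + 1 + 1) * S).trace))) atTop (nhds 0) := by
      have := ((tendsto_const_nhds (x := (n : ℝ))).sub key).const_mul 2 |>.sqrt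
      simpa using this
    refine tendsto_pi_nhds.2 fun i => tendsto_pi_nhds.2 fun j => ?_
    rw [tendsto_iff_norm_sub_tendsto_zero]
    refine squeeze_zero (fun _ => norm_nonneg _) (fun k => ?_) hz
    rw [Real.norm_eq_abs]
    apply Real.abs_le_sqrt
    have h := fi_entry (X (k + 1 + 1) * S - 1) i j
    rw [fi_sub_left, fi_sub_right, fi_sub_right, hYn, fi_comm 1 (X (k + 1 + 1) * S)] at h
    have h5 : finner (X (k + 1 + 1) * S) 1 = (X (k + 1 + 1) * S).trace := by simp [finner, hYs]
    have h6 : finner (1 : Matrix (Fin n) (Fin n) ℝ) 1 = n := by simp [finner]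
    rw [h5, h6] at h
    rw [Matrix.sub_apply] at h
    linarith
  have hdet : IsUnit S.det := by rw [hS]; exact (Matrix.isUnit_iff_isUnit_det _).1 hA
  have hfin : Tendsto (fun k => (X (k + 1 + 1) * S) * S⁻¹) atTop (nhds (1 * S⁻¹)) := by
    have hcont : Continuous fun M : Matrix (Fin n) (Fin n) ℝ => M * S⁻¹ := by fun_prop
    exact (hcont.tendsto 1).comp hY1
  rw [← hS]
  rw [Matrix.one_mul] at hfin
  simp only [Matrix.mul_assoc, Matrix.mul_nonsing_inv S hdet, Matrix.mul_one] at hfin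
  exact (tendsto_add_atTop_iff_nat 2).1 hfin
end
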